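/- arXiv:1601.01103 — 2 statements merged into one kernel-verified Lean document; each statement's English description precedes it below -/
import Mathlib

section
/- Let R be a chain ring whose set of zero-divisors Z is nonzero. Then no almost FP-injective R-module has weak dimension equal to 1: for every almost FP-injective R-module G, w.d.(G) ≠ 1. -/
open CategoryTheory

universe u

/-- A chain ring: the lattice of ideals is totally ordered by inclusion. -/
def IsChainRing (R : Type u) [CommRing R] : Prop :=
  ∀ I J : Ideal R, I ≤ J ∨ J ≤ I

/-- The set of zero-divisors of `R`. -/
def zeroDivisorsSet (R : Type u) [CommRing R] : Set R :=
  {r : R | ∃ s : R, s ≠ 0 ∧ r * s = 0}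

/-- An `R`-module `E` is FP-injective if `Ext¹_R(F, E) = 0` for every finitely
presented `R`-module `F`. -/
def IsFPInjective (R : Type u) [CommRing R] (E : Type u) [AddCommGroup E] [Module R E] : Prop :=
  ∀ F : ModuleCat.{u} R, Module.FinitePresentation R F →
    Limits.IsZero (((Ext R (ModuleCat.{u} R) 1).obj (Opposite.op F)).obj (ModuleCat.of R E))

/-- A submodule `D ≤ E` is pure if `0 → D ⊗ N → E ⊗ N` is exact for every module `N`,
i.e. the sequence `0 → D → E → E/D → 0` remains exact after tensoring with any module. -/
def IsPureSubmodule {R : Type u} [CommRing R] {E : Type u} [AddCommGroup E] [Module R E]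
    (D : Submodule R E) : Prop :=
  ∀ (N : Type u) [AddCommGroup N] [Module R N],
    Function.Injective (LinearMap.rTensor N D.subtype)

/-- An `R`-module `G` is almost FP-injective if `G ≅ E/D` for some FP-injective module `E`
and pure submodule `D` of `E`. -/
def IsAlmostFPInjective (R : Type u) [CommRing R] (G : Type u) [AddCommGroup G]
    [Module R G] : Prop :=
  ∃ (E : Type u) (_ : AddCommGroup E) (_ : Module R E) (D : Submodule R E),
    IsFPInjective R E ∧ IsPureSubmodule D ∧ Nonempty ((E ⧸ D) ≃ₗ[R] G)

/-- The weak dimension of a module, as an element of `ℕ∞`: the least `n` such that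
`Tor_{n+1}(M, N) = 0` for all modules `N` (and `⊤ = ∞` if there is no such `n`). -/
noncomputable def weakDim (R : Type u) [CommRing R] (M : Type u) [AddCommGroup M]
    [Module R M] : ℕ∞ :=
  sInf {n : ℕ∞ | ∃ k : ℕ, n = k ∧ ∀ N : ModuleCat.{u} R,
    Limits.IsZero (((Tor (ModuleCat.{u} R) (k + 1)).obj (ModuleCat.of R M)).obj N)}

/-- The projective dimension of a module, as an element of `ℕ∞`: the least `n` such that
`Ext^{n+1}(M, N) = 0` for all modules `N` (and `⊤ = ∞` if there is no such `n`). -/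
noncomputable def projDim (R : Type u) [CommRing R] (M : Type u) [AddCommGroup M]
    [Module R M] : ℕ∞ :=
  sInf {n : ℕ∞ | ∃ k : ℕ, n = k ∧ ∀ N : ModuleCat.{u} R,
    Limits.IsZero (((Ext R (ModuleCat.{u} R) (k + 1)).obj
      (Opposite.op (ModuleCat.of R M))).obj N)}

/-- An IF-ring: every injective module is flat. -/
def IsIFRing (R : Type u) [CommRing R] : Prop :=
  ∀ (M : Type u) [AddCommGroup M] [Module R M], Module.Injective R M → Module.Flat R M

/-- A semicoherent ring: `Hom_R(E, F)` embeds into a flat module for every pair of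
injective modules `E`, `F`. -/
def IsSemicoherent (R : Type u) [CommRing R] : Prop :=
  ∀ (E F : Type u) [AddCommGroup E] [Module R E] [AddCommGroup F] [Module R F],
    Module.Injective R E → Module.Injective R F →
      ∃ (W : Type u) (_ : AddCommGroup W) (_ : Module R W),
        Module.Flat R W ∧ ∃ f : (E →ₗ[R] F) →ₗ[R] W, Function.Injective f

/-- A coherent ring: every finitely generated ideal is finitely presented. -/
def IsCoherentRing (R : Type u) [CommRing R] : Prop :=
  ∀ I : Ideal R, I.FG → Module.FinitePresentation R I

/-- `i : M →ₗ[R] E` exhibits `E` as an injective hull of `M`: `E` is injective and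
`i` is an essential embedding. -/
def IsInjectiveHull (R : Type u) [CommRing R] (M E : Type u) [AddCommGroup M] [Module R M]
    [AddCommGroup E] [Module R E] (i : M →ₗ[R] E) : Prop :=
  Module.Injective R E ∧ Function.Injective i ∧
    ∀ K : Submodule R E, K ≠ ⊥ → K ⊓ LinearMap.range i ≠ ⊥

/-- The bottom prime ideal `M_♯` (as a set): elements killing some nonzero element of `M`. -/
def bottomSet (R : Type u) [CommRing R] (M : Type u) [AddCommGroup M] [Module R M] : Set R :=
  {s : R | ∃ x : M, x ≠ 0 ∧ s • x = 0}

/-- The top prime ideal `M^♯` (as a set): elements `s` with `sM ⊊ M`. -/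
def topSet (R : Type u) [CommRing R] (M : Type u) [AddCommGroup M] [Module R M] : Set R :=
  {s : R | ¬ Function.Surjective fun x : M => s • x}


open Limits

lemma CategoryTheory.ShortComplex.exact_congr {C : Type*} [Category* C] [HasZeroMorphisms C]
    {X₁ X₂ X₃ : C} {f f' : X₁ ⟶ X₂} {g g' : X₂ ⟶ X₃} {w : f ≫ g = 0}
    (h : (ShortComplex.mk f g w).Exact) (hf : f' = f) (hg : g' = g) (w' : f' ≫ g' = 0) :
    (ShortComplex.mk f' g' w').Exact := by
  subst hf hg
  exact h

namespace CategoryTheory.ProjectiveResolution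

variable {C : Type*} [Category* C] [Abelian C] [EnoughProjectives C] {X Y : C}

/-- The sequence of morphisms obtained from `f` by iterating `Projective.d`. -/
noncomputable def iteratedSyzygy (f : X ⟶ Y) : ℕ → Σ (A B : C), (A ⟶ B)
  | 0 => ⟨X, Y, f⟩
  | n + 1 => ⟨Projective.syzygies (iteratedSyzygy f n).2.2, (iteratedSyzygy f n).1,
      Projective.d (iteratedSyzygy f n).2.2⟩

/-- The chain complex `⋯ ⟶ X₂ ⟶ X ⟶ Y` extending `f : X ⟶ Y` to the left by projective covers of
syzygies. -/
noncomputable def ofMorphismComplex (f : X ⟶ Y) : ChainComplex C ℕ :=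
  ChainComplex.of (fun n => (iteratedSyzygy f n).2.1) (fun n => (iteratedSyzygy f n).2.2)
    (fun n => (Category.assoc _ _ _).trans
      ((congrArg _ (kernel.condition (iteratedSyzygy f n).2.2)).trans comp_zero))

lemma ofMorphismComplex_d (f : X ⟶ Y) (n : ℕ) :
    (ofMorphismComplex f).d (n + 1) n = (iteratedSyzygy f n).2.2 :=
  ChainComplex.of_d (fun n => (iteratedSyzygy f n).2.1) (fun n => (iteratedSyzygy f n).2.2) n

lemma ofMorphismComplex_d_one_zero (f : X ⟶ Y) : (ofMorphismComplex f).d 1 0 = f :=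
  ofMorphismComplex_d f 0

lemma ofMorphismComplex_exactAt_succ (f : X ⟶ Y) (n : ℕ) :
    (ofMorphismComplex f).ExactAt (n + 1) := by
  rw [HomologicalComplex.exactAt_iff' _ (n + 1 + 1) (n + 1) n (by simp) (by simp)]
  exact ShortComplex.exact_congr (exact_d_f (iteratedSyzygy f n).2.2)
    (ofMorphismComplex_d f (n + 1)) (ofMorphismComplex_d f n) _

lemma projective_ofMorphismComplex (f : X ⟶ Y) [hX : Projective X] [hY : Projective Y] :
    ∀ n : ℕ, Projective ((ofMorphismComplex f).X n)
  | 0 => hY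
  | 1 => hX
  | n + 2 => inferInstanceAs (Projective (Projective.syzygies (iteratedSyzygy f n).2.2))

/-- A morphism `f` between projective objects is the start of a projective resolution of its
cokernel. -/
noncomputable def ofMorphism (f : X ⟶ Y) [Projective X] [Projective Y] {Z : C} (π : Y ⟶ Z)
    [hπ : Epi π] (w : f ≫ π = 0) (h : (ShortComplex.mk f π w).Exact) : ProjectiveResolution Z where
  complex := ofMorphismComplex f
  projective := projective_ofMorphismComplex f
  π := (ChainComplex.toSingle₀Equiv _ _).symm
    ⟨π, (congrArg (· ≫ π) (ofMorphismComplex_d_one_zero f)).trans w⟩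
  quasiIso := ⟨fun n => by
    cases n
    · rw [ChainComplex.quasiIsoAt₀_iff, ShortComplex.quasiIso_iff_of_zeros']
      · have e := ChainComplex.toSingle₀Equiv_symm_apply_f_zero (C := ofMorphismComplex f) π
          ((congrArg (· ≫ π) (ofMorphismComplex_d_one_zero f)).trans w)
        exact ⟨ShortComplex.exact_congr h (ofMorphismComplex_d_one_zero f) e _,
          (congrArg Epi e).mpr hπ⟩
      all_goals rfl
    · rw [quasiIsoAt_iff_exactAt']
      · apply ofMorphismComplex_exactAt_succ
      · apply ChainComplex.exactAt_succ_single_obj⟩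

end CategoryTheory.ProjectiveResolution

section ChainRing

variable {R : Type u} [CommRing R]

/-- A projective resolution of `R ⧸ (a)` starting with multiplication by `a` on `R`. -/
noncomputable def principalQuotientResolution (a : R) :
    ProjectiveResolution (ModuleCat.of R (R ⧸ Ideal.span {a})) :=
  haveI : Projective (ModuleCat.of R R) :=
    (IsProjective.iff_projective (R := R) R).mp inferInstance
  haveI : Epi (ModuleCat.ofHom (Ideal.span {a}).mkQ) :=
    (ModuleCat.epi_iff_surjective _).2 (Submodule.mkQ_surjective _)
  ProjectiveResolution.ofMorphism (ModuleCat.ofHom (LinearMap.lsmul R R a))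
    (ModuleCat.ofHom (Ideal.span {a}).mkQ)
    (by
      ext
      simp only [ModuleCat.hom_comp, ModuleCat.hom_ofHom, LinearMap.comp_apply,
        ModuleCat.hom_zero, LinearMap.zero_apply]
      exact (Submodule.Quotient.mk_eq_zero _).2 (by simp))
    (by
      rw [ShortComplex.ShortExact.moduleCat_exact_iff_function_exact]
      intro x
      change Submodule.Quotient.mk x = 0 ↔ ∃ y, a • y = x
      rw [Submodule.Quotient.mk_eq_zero, Ideal.mem_span_singleton]
      exact ⟨fun ⟨y, hy⟩ => ⟨y, hy.symm⟩, fun ⟨y, hy⟩ => ⟨y, hy.symm⟩⟩)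

lemma principalQuotientResolution_d_one_zero (a : R) :
    (principalQuotientResolution a).complex.d 1 0 =
      ModuleCat.ofHom (LinearMap.lsmul R R a) :=
  ProjectiveResolution.ofMorphismComplex_d_one_zero _

/-- The differential of `principalQuotientResolution a` with target `R`. -/
noncomputable def principalQuotientResolutionD (a : R) :
    (principalQuotientResolution a).complex.X 2 →ₗ[R] R :=
  ((principalQuotientResolution a).complex.d 2 1).hom

lemma exact_principalQuotientResolutionD (a : R) :
    Function.Exact (principalQuotientResolutionD a) (LinearMap.lsmul R R a) := by
  have h := (principalQuotientResolution a).exact_succ 0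
  rw [ShortComplex.ShortExact.moduleCat_exact_iff_function_exact] at h
  have e := principalQuotientResolution_d_one_zero a
  intro x
  refine Iff.trans ?_ (h x)
  exact (Eq.congr (congrArg (fun f : ModuleCat.of R R ⟶ ModuleCat.of R R => f.hom x) e.symm)
    rfl)

/-- Over an FP-injective module, `e` is divisible by `a` as soon as it is killed by the
annihilator of `a`. -/
lemma IsFPInjective.exists_smul_eq {E : Type u} [AddCommGroup E] [Module R E]
    (hE : IsFPInjective R E) (a : R) (e : E) (h : ∀ b : R, a * b = 0 → b • e = 0) :
    ∃ y : E, a • y = e := by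
  have h0 := hE (ModuleCat.of R (R ⧸ Ideal.span {a}))
    (Module.finitePresentation_of_surjective (Ideal.span {a}).mkQ (Submodule.mkQ_surjective _)
      (by rw [Submodule.ker_mkQ]; exact ⟨{a}, by simp⟩))
  have h1 := h0.of_iso ((principalQuotientResolution a).isoExt 1 (ModuleCat.of R E)).symm
  rw [← HomologicalComplex.exactAt_iff_isZero_homology,
    HomologicalComplex.exactAt_iff' _ 0 1 2 (by simp) (by simp),
    ShortComplex.ShortExact.moduleCat_exact_iff_function_exact] at h1
  let φ : (principalQuotientResolution a).complex.X 1 ⟶ ModuleCat.of R E :=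
    ModuleCat.ofHom (LinearMap.toSpanSingleton R E e)
  have hφ : (principalQuotientResolution a).complex.d 2 1 ≫ φ = 0 := by
    ext x
    exact h _ ((exact_principalQuotientResolutionD a _).2 ⟨x, rfl⟩)
  obtain ⟨ψ, hψ⟩ := (h1 φ).1 hφ
  change (principalQuotientResolution a).complex.d 1 0 ≫ ψ = φ at hψ
  rw [principalQuotientResolution_d_one_zero] at hψ
  let ψ' : R →ₗ[R] E := ψ.hom
  refine ⟨ψ' 1, ?_⟩
  have h2 : ψ' (a • 1) = (1 : R) • e :=
    congrArg (fun f : ModuleCat.of R R ⟶ ModuleCat.of R E => f.hom (1 : R)) hψ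
  rw [← map_smul, h2, one_smul]

lemma IsPureSubmodule.exists_smul_eq {E : Type u} [AddCommGroup E] [Module R E]
    {D : Submodule R E} (hD : IsPureSubmodule D) (a : R) (e : E) (he : a • e ∈ D) :
    ∃ d ∈ D, a • d = a • e := by
  have h : (⟨a • e, he⟩ : D) ⊗ₜ[R] (1 : R ⧸ Ideal.span {a}) = 0 := by
    apply hD
    rw [LinearMap.rTensor_tmul, map_zero, Submodule.subtype_apply, TensorProduct.smul_tmul,
      Algebra.smul_def, mul_one, Ideal.Quotient.algebraMap_eq,
      Ideal.Quotient.eq_zero_iff_mem.2 (Ideal.mem_span_singleton_self a), TensorProduct.tmul_zero]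
  have h' := congrArg (TensorProduct.tensorQuotEquivQuotSMul D (Ideal.span {a})) h
  rw [← map_one (Ideal.Quotient.mk _), TensorProduct.tensorQuotEquivQuotSMul_tmul_mk, one_smul,
    map_zero, Submodule.Quotient.mk_eq_zero, Submodule.ideal_span_singleton_smul,
    Submodule.mem_smul_pointwise_iff_exists] at h'
  obtain ⟨d, -, hd⟩ := h'
  exact ⟨d, d.2, congrArg Subtype.val hd⟩

/-- If `Tor₂(G, R ⧸ (r)) = 0` then `G ⊗ (0 : r) → G` is injective. -/
lemma tmul_eq_zero_of_isZero_tor_two {G : Type u} [AddCommGroup G] [Module R G] (r : R)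
    (hG : IsZero (((Tor (ModuleCat.{u} R) 2).obj (ModuleCat.of R G)).obj
      (ModuleCat.of R (R ⧸ Ideal.span {r}))))
    (y : G) (i : LinearMap.ker (LinearMap.lsmul R R r)) (hy : (i : R) • y = 0) :
    i ⊗ₜ[R] y = 0 := by
  let P := principalQuotientResolution r
  have h1 := hG.of_iso
    (P.isoLeftDerivedObj ((MonoidalCategory.tensoringLeft (ModuleCat.{u} R)).obj
      (ModuleCat.of R G)) 2).symm
  replace h1 : (((MonoidalCategory.tensorLeft (ModuleCat.of R G)).mapHomologicalComplex
      _).obj P.complex).ExactAt 2 := (HomologicalComplex.exactAt_iff_isZero_homology _ _).2 h1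
  rw [HomologicalComplex.exactAt_iff' _ 3 2 1 (by simp) (by simp),
    ShortComplex.ShortExact.moduleCat_exact_iff_function_exact] at h1
  have h2 : Function.Exact ((P.complex.d 3 2).hom.lTensor G)
      ((principalQuotientResolutionD r).lTensor G) := h1
  obtain ⟨p, hp⟩ := (exact_principalQuotientResolutionD r (i : R)).1 i.2
  obtain ⟨w, hw⟩ := (h2 (y ⊗ₜ p)).1 (by
    rw [LinearMap.lTensor_tmul, hp, ← mul_one (i : R), ← smul_eq_mul, TensorProduct.tmul_smul,
      TensorProduct.smul_tmul', hy, TensorProduct.zero_tmul])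
  let d' : P.complex.X 2 →ₗ[R] LinearMap.ker (LinearMap.lsmul R R r) :=
    (principalQuotientResolutionD r).codRestrict _
      fun x => (exact_principalQuotientResolutionD r _).2 ⟨x, rfl⟩
  have hd : d' ∘ₗ (P.complex.d 3 2).hom = 0 := by
    ext x
    exact congrArg (fun f => f.hom x) (P.complex.d_comp_d 3 2 1)
  have hi : d' p = i := Subtype.ext hp
  apply (TensorProduct.comm R _ _).injective
  rw [TensorProduct.comm_tmul, map_zero, ← hi, ← LinearMap.lTensor_tmul, ← hw,
    ← LinearMap.lTensor_comp_apply, hd, LinearMap.lTensor_zero, LinearMap.zero_apply]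

/-- Flat modules have weak dimension zero. -/
lemma weakDim_eq_zero_of_flat (G : Type u) [AddCommGroup G] [Module R G] [Module.Flat R G] :
    weakDim R G = 0 := by
  refine le_antisymm (sInf_le ⟨0, rfl, fun N => ?_⟩) bot_le
  let P := ProjectiveResolution.of N
  refine IsZero.of_iso ?_ (P.isoLeftDerivedObj ((MonoidalCategory.tensoringLeft
    (ModuleCat.{u} R)).obj (ModuleCat.of R G)) 1)
  refine (HomologicalComplex.exactAt_iff_isZero_homology
    (((MonoidalCategory.tensorLeft (ModuleCat.of R G)).mapHomologicalComplex _).obj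
      P.complex) 1).1 ?_
  rw [HomologicalComplex.exactAt_iff' _ 2 1 0 (by simp) (by simp),
    ShortComplex.ShortExact.moduleCat_exact_iff_function_exact]
  have hP : Function.Exact (P.complex.d 2 1).hom (P.complex.d 1 0).hom :=
    (ShortComplex.ShortExact.moduleCat_exact_iff_function_exact _).1 (P.exact_succ 0)
  exact Module.Flat.lTensor_exact G hP

lemma isZero_tor_two_of_weakDim_eq_one {G : Type u} [AddCommGroup G] [Module R G]
    (h : weakDim R G = 1) (N : ModuleCat.{u} R) :
    IsZero (((Tor (ModuleCat.{u} R) 2).obj (ModuleCat.of R G)).obj N) := by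
  have hne : {n : ℕ∞ | ∃ k : ℕ, n = k ∧ ∀ N : ModuleCat.{u} R,
    IsZero (((Tor (ModuleCat.{u} R) (k + 1)).obj (ModuleCat.of R G)).obj N)}.Nonempty := by
    by_contra hne
    rw [Set.not_nonempty_iff_eq_empty] at hne
    rw [weakDim, hne, sInf_empty] at h
    simp at h
  obtain ⟨k, hk, hN⟩ := csInf_mem hne
  change weakDim R G = k at hk
  rw [h] at hk
  obtain rfl : k = 1 := by exact_mod_cast hk.symm
  exact hN N

lemma IsChainRing.dvd_or_dvd (hR : IsChainRing R) (a b : R) : a ∣ b ∨ b ∣ a := by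
  simpa only [Ideal.span_singleton_le_span_singleton, or_comm] using
    hR (Ideal.span {a}) (Ideal.span {b})

lemma IsChainRing.exists_eq_span (hR : IsChainRing R) {I : Ideal R} (hI : I.FG) :
    ∃ a, I = Ideal.span {a} := by
  have : IsBezout R := IsBezout.iff_span_pair_isPrincipal.2 fun x y => by
    rcases hR.dvd_or_dvd x y with h | h
    · exact ⟨x, by
        rw [Ideal.submodule_span_eq, Ideal.span_pair_eq_span_left_iff_dvd.2 h]⟩
    · exact ⟨y, by
        rw [Ideal.submodule_span_eq, Ideal.span_pair_eq_span_right_iff_dvd.2 h]⟩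
  exact (IsBezout.isPrincipal_of_FG I hI).principal

/-- Over a chain ring, a finite sum of elements of `(0 : j) G` is a multiple of one element of
`(0 : j)`. -/
lemma IsChainRing.exists_smul_eq_sum (hR : IsChainRing R) {G : Type u} [AddCommGroup G]
    [Module R G] (j : R) {ι : Type*} (s : Finset ι) (c : ι → R) (g : ι → G)
    (hc : ∀ k, c k * j = 0) : ∃ (b : R) (x : G), ∑ k ∈ s, c k • g k = b • x ∧ b * j = 0 := by
  classical
  induction s using Finset.induction_on with
  | empty => exact ⟨0, 0, by simp, by simp⟩
  | insert k s hk ih =>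
    obtain ⟨b, x, hx, hb⟩ := ih
    rw [Finset.sum_insert hk, hx]
    rcases hR.dvd_or_dvd (c k) b with ⟨u, rfl⟩ | ⟨u, hu⟩
    · exact ⟨c k, g k + u • x, by rw [smul_add, mul_smul], hc k⟩
    · exact ⟨b, u • g k + x, by rw [hu, smul_add, mul_smul], hb⟩

/-- If `Tor₂(G, R ⧸ (r)) = 0`, `i` and `k` annihilate `r` and `i` annihilates `y`, then there is a
common divisor `j` of `i` and `k` annihilating `r`, such that `(i / j) y ∈ (0 : j) G`. -/
lemma IsChainRing.exists_factor_of_isZero_tor_two (hR : IsChainRing R) {G : Type u}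
    [AddCommGroup G] [Module R G] (r : R)
    (hG : IsZero (((Tor (ModuleCat.{u} R) 2).obj (ModuleCat.of R G)).obj
      (ModuleCat.of R (R ⧸ Ideal.span {r}))))
    (i k : R) (hi : r * i = 0) (hk : r * k = 0) (y : G) (hy : i • y = 0) :
    ∃ j t c : R, ∃ g : G, r * j = 0 ∧ j ∣ k ∧ i = j * t ∧ t • y = c • g ∧ c * j = 0 := by
  have h0 := tmul_eq_zero_of_isZero_tor_two r hG y ⟨i, hi⟩ hy
  let I : Ideal R := LinearMap.ker (LinearMap.lsmul R R r)
  let I₀ : Submodule R I := Submodule.span R {⟨i, hi⟩, ⟨k, hk⟩}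
  have hi₀ : (⟨i, hi⟩ : I) ∈ I₀ := Submodule.subset_span (by simp)
  have hk₀ : (⟨k, hk⟩ : I) ∈ I₀ := Submodule.subset_span (by simp)
  obtain ⟨J, hJ, hle, h1⟩ := Submodule.FG.exists_rTensor_fg_inclusion_eq (M := G) (N := I₀)
    (Submodule.fg_span (by simp)) (x := (⟨⟨i, hi⟩, hi₀⟩ : I₀) ⊗ₜ[R] y) (y := 0)
    (by rw [LinearMap.rTensor_tmul, map_zero]; exact h0)
  rw [LinearMap.rTensor_tmul, map_zero] at h1
  obtain ⟨j, hj⟩ := hR.exists_eq_span (hJ.map I.subtype)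
  have hdvd : ∀ x : I, x ∈ J → j ∣ (x : R) := fun x hx => by
    rw [← Ideal.mem_span_singleton, ← hj]
    exact Submodule.mem_map_of_mem hx
  have hjJ : j ∈ J.map I.subtype := hj ▸ Ideal.mem_span_singleton_self j
  obtain ⟨j', hj'J, rfl⟩ := hjJ
  obtain ⟨t, ht⟩ := hdvd _ (hle hi₀)
  have hspan : Submodule.span R (Set.range fun _ : Unit => (⟨j', hj'J⟩ : J)) = ⊤ := by
    refine Submodule.eq_top_iff'.2 fun x => ?_
    obtain ⟨u, hu⟩ := hdvd x x.2
    rw [Set.range_const, Submodule.mem_span_singleton]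
    exact ⟨u, Subtype.ext (Subtype.ext ((mul_comm _ _).trans hu.symm))⟩
  have ht' : I₀.inclusion hle ⟨⟨i, hi⟩, hi₀⟩ = t • (⟨j', hj'J⟩ : J) :=
    Subtype.ext (Subtype.ext (ht.trans (mul_comm _ _)))
  rw [ht', TensorProduct.smul_tmul] at h1
  obtain ⟨n, a, g, hg, ha⟩ := TensorProduct.vanishesTrivially_of_sum_tmul_eq_zero R
    (n := fun _ : Unit => t • y) hspan (by simpa using h1)
  obtain ⟨c, x, hx, hc⟩ := hR.exists_smul_eq_sum (j' : R) Finset.univ (a ()) g fun l => by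
    have := congrArg (fun z : J => ((z : I) : R)) (ha l)
    simpa using this
  exact ⟨j', t, c, x, j'.2, hdvd _ (hle hk₀), ht, (hg ()).trans hx, hc⟩

/-- A module over a chain ring is flat if the elements killed by `a` lie in `(0 : a) G`. -/
lemma IsChainRing.flat_of_forall (hR : IsChainRing R) {G : Type u} [AddCommGroup G] [Module R G]
    (h : ∀ (a : R) (x : G), a • x = 0 → ∃ (ι : Type) (_ : Fintype ι) (c : ι → R) (g : ι → G),
      x = ∑ k, c k • g k ∧ ∀ k, c k * a = 0) : Module.Flat R G := by
  rw [Module.Flat.iff_lift_lsmul_comp_subtype_injective]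
  intro I hI
  obtain ⟨a, rfl⟩ := hR.exists_eq_span hI
  let a' : Ideal.span {a} := ⟨a, Ideal.mem_span_singleton_self a⟩
  have key : ∀ z : TensorProduct R (Ideal.span {a}) G, ∃ x : G, z = TensorProduct.tmul R a' x := by
    intro z
    induction z with
    | zero => exact ⟨0, by simp⟩
    | tmul u x =>
      obtain ⟨v, hv⟩ := Ideal.mem_span_singleton.1 u.2
      have : u = v • a' := Subtype.ext (hv.trans (mul_comm _ _))
      exact ⟨v • x, by rw [this, TensorProduct.smul_tmul]⟩
    | add z w hz hw =>
      obtain ⟨x, rfl⟩ := hz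
      obtain ⟨y, rfl⟩ := hw
      exact ⟨x + y, (TensorProduct.tmul_add _ _ _).symm⟩
  refine (injective_iff_map_eq_zero _).2 fun z hz => ?_
  obtain ⟨x, rfl⟩ := key z
  obtain ⟨ι, _, c, g, rfl, hc⟩ := h a x (by simpa [a'] using hz)
  rw [TensorProduct.tmul_sum]
  refine Finset.sum_eq_zero fun k _ => ?_
  rw [← TensorProduct.smul_tmul, show c k • a' = 0 from Subtype.ext (hc k),
    TensorProduct.zero_tmul]

/-- In an almost FP-injective module, an element killed by `a` is divisible by every `r` such that
`(0 : r) ⊆ (a)`. -/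
lemma IsAlmostFPInjective.exists_smul_eq {G : Type u} [AddCommGroup G] [Module R G]
    (hG : IsAlmostFPInjective R G) (a r : R) (h : ∀ b, r * b = 0 → a ∣ b) (x : G)
    (hx : a • x = 0) : ∃ y : G, r • y = x := by
  obtain ⟨E, _, _, D, hE, hD, ⟨f⟩⟩ := hG
  obtain ⟨e, he⟩ := Submodule.Quotient.mk_surjective D (f.symm x)
  have hae : a • e ∈ D := by
    rw [← Submodule.Quotient.mk_eq_zero, Submodule.Quotient.mk_smul, he, ← map_smul, hx, map_zero]
  obtain ⟨d, hdD, hd⟩ := hD.exists_smul_eq a e hae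
  obtain ⟨y, hy⟩ := hE.exists_smul_eq r (e - d) fun b hb => by
    obtain ⟨u, rfl⟩ := h b hb
    rw [mul_comm, mul_smul, smul_sub, hd, sub_self, smul_zero]
  refine ⟨f (Submodule.Quotient.mk y), ?_⟩
  rw [← map_smul, ← Submodule.Quotient.mk_smul, hy, Submodule.Quotient.mk_sub, he,
    (Submodule.Quotient.mk_eq_zero D).2 hdD, sub_zero, LinearEquiv.apply_symm_apply]

/-- An almost FP-injective module `G` over a chain ring with nonzero zero-divisors is flat if
`Tor₂(G, R ⧸ (r)) = 0` for all `r`. -/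
lemma IsAlmostFPInjective.flat_of_isZero_tor_two (hR : IsChainRing R)
    (hz : ∃ z s : R, z ≠ 0 ∧ s ≠ 0 ∧ z * s = 0)
    {G : Type u} [AddCommGroup G] [Module R G] (hG : IsAlmostFPInjective R G)
    (hT : ∀ N : ModuleCat.{u} R,
      IsZero (((Tor (ModuleCat.{u} R) 2).obj (ModuleCat.of R G)).obj N)) :
    Module.Flat R G := by
  refine hR.flat_of_forall fun a x hax => ?_
  by_cases ha0 : a = 0
  · exact ⟨Unit, inferInstance, fun _ => 1, fun _ => x, by simp, by simp [ha0]⟩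
  by_cases hreg : ∃ r, r ≠ 0 ∧ r * a = 0
  · obtain ⟨r, hr0, hra⟩ := hreg
    obtain ⟨j, t, c, g, hrj, -, rfl, htx, hcj⟩ :=
      hR.exists_factor_of_isZero_tor_two r (hT _) a 0 hra (mul_zero _) x hax
    obtain ⟨c', rfl⟩ : t ∣ c := by
      rcases hR.dvd_or_dvd t c with h | ⟨v, rfl⟩
      · exact h
      · exact absurd (by linear_combination v * hcj) ha0
    obtain ⟨s', rfl⟩ : t ∣ r := by
      rcases hR.dvd_or_dvd t r with h | ⟨v, rfl⟩
      · exact h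
      · exact absurd (by linear_combination v * hrj) ha0
    obtain ⟨y, hy⟩ := hG.exists_smul_eq t s' (fun b hb => by
        rcases hR.dvd_or_dvd t b with h | ⟨v, rfl⟩
        · exact h
        · exact absurd (by linear_combination v * hb) hr0) (x - c' • g)
        (by rw [smul_sub, htx, mul_smul, sub_self])
    refine ⟨Fin 2, inferInstance, ![c', s'], ![g, y], by simp [hy], fun k => ?_⟩
    fin_cases k
    · simp only [Fin.zero_eta, Matrix.cons_val_zero]; linear_combination hcj
    · simp only [Fin.mk_one, Matrix.cons_val_one, Matrix.cons_val_fin_one]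
      linear_combination hrj
  · push Not at hreg
    have hreg' : ∀ b, a * b = 0 → b = 0 := fun b hb =>
      not_imp_not.1 (hreg b) (by rwa [mul_comm])
    suffices x = 0 from ⟨Empty, inferInstance, Empty.elim, Empty.elim, by simp [this], nofun⟩
    obtain ⟨z, s, hz0, hs0, hzs⟩ := hz
    have hdvd : ∀ b c : R, c ≠ 0 → b * c = 0 → a ∣ b := fun b c hc hbc => by
      rcases hR.dvd_or_dvd a b with h | ⟨v, rfl⟩
      · exact h
      · exact absurd (by linear_combination v * hbc) (hreg c hc)
    obtain ⟨y, rfl⟩ := hG.exists_smul_eq a z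
      (fun b hb => hdvd b z hz0 (by rwa [mul_comm])) x hax
    obtain ⟨j, t, c, g, hsj, ⟨w, rfl⟩, hjt, hty, hcj⟩ :=
      hR.exists_factor_of_isZero_tor_two s (hT _) (a * z) z (by linear_combination a * hzs)
        (by linear_combination hzs) y (by rw [mul_smul, hax])
    have hj0 : j ≠ 0 := left_ne_zero_of_mul hz0
    obtain ⟨j', hj'⟩ := hdvd j s hs0 (by linear_combination hsj)
    obtain ⟨c₁, rfl⟩ := hdvd c j hj0 hcj
    obtain ⟨d, hd⟩ := hdvd (a * w - t) j hj0 (by linear_combination hjt)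
    have hc₁ : j * c₁ = 0 := hreg' _ (by linear_combination hcj)
    have hdj : j * d = 0 := hreg' _ (by linear_combination hjt - j * hd)
    have hv : a • (w • y - c₁ • g - d • y) = 0 := by
      rw [smul_sub, smul_sub, smul_smul, smul_smul, smul_smul, ← hty, ← hd, sub_smul]
      abel
    have hjv : j • (w • y - c₁ • g - d • y) = 0 := by
      rw [hj', mul_comm, mul_smul, hv, smul_zero]
    simpa [smul_sub, smul_smul, hc₁, hdj] using hjv

end ChainRing

/-- Over a chain ring `R` whose ideal `Z` of zero-divisors is nonzero,
no almost FP-injective module has weak dimension `1`. -/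
theorem weakDim_ne_one_of_almostFPInjective (R : Type u) [CommRing R]
    (hR : IsChainRing R)
    (Z : Ideal R) (hZ : (Z : Set R) = zeroDivisorsSet R) (hZ0 : Z ≠ ⊥)
    (G : Type u) [AddCommGroup G] [Module R G] (hG : IsAlmostFPInjective R G) :
    weakDim R G ≠ 1 := by
  intro h
  obtain ⟨z, hzZ, hz0⟩ := Submodule.exists_mem_ne_zero_of_ne_bot hZ0
  obtain ⟨s, hs0, hzs⟩ : z ∈ zeroDivisorsSet R := hZ ▸ hzZ
  have := hG.flat_of_isZero_tor_two hR ⟨z, s, hz0, hs0, hzs⟩ (isZero_tor_two_of_weakDim_eq_one h)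
  rw [weakDim_eq_zero_of_flat] at h
  exact zero_ne_one h
end

section
/- Let R be a valuation domain which is not a field and let G be a nonzero almost FP-injective R-module. Then w.d.(G) = 0 if G_♯ = 0 (i.e., G is torsion-free), and w.d.(G) = 1 if G_♯ ≠ 0. -/
open CategoryTheory

universe u

open Limits TensorProduct MonoidalCategory in
/-- `Tor_{n+1}(G, N)` vanishes iff tensoring a projective resolution of `N` with `G` yields an
exact sequence in degree `n + 1`. -/
lemma isZero_tor_succ_iff {R : Type u} [CommRing R] (G : Type u) [AddCommGroup G] [Module R G]
    {N : ModuleCat.{u} R} (P : ProjectiveResolution N) (n : ℕ) :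
    IsZero (((Tor (ModuleCat.{u} R) (n + 1)).obj (ModuleCat.of R G)).obj N) ↔
      Function.Exact (LinearMap.lTensor G (P.complex.d (n + 2) (n + 1)).hom)
        (LinearMap.lTensor G (P.complex.d (n + 1) n).hom) := by
  rw [Tor_obj, (P.isoLeftDerivedObj ((tensoringLeft (ModuleCat.{u} R)).obj (ModuleCat.of R G))
    (n + 1)).isZero_iff]
  refine (HomologicalComplex.exactAt_iff_isZero_homology _ _).symm.trans ?_
  rw [HomologicalComplex.exactAt_iff' _ (n + 2) (n + 1) n (by simp only [ChainComplex.prev]; rfl)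
    (by simp), ShortComplex.ShortExact.moduleCat_exact_iff_function_exact]
  rfl

/-- A projective resolution is exact in positive degrees, as a sequence of linear maps. -/
lemma CategoryTheory.ProjectiveResolution.function_exact_succ {R : Type u} [CommRing R]
    {N : ModuleCat.{u} R} (P : ProjectiveResolution N) (n : ℕ) :
    Function.Exact (P.complex.d (n + 2) (n + 1)).hom (P.complex.d (n + 1) n).hom :=
  (ShortComplex.ShortExact.moduleCat_exact_iff_function_exact _).1 (P.exact_succ n)

/-- Over a Bezout domain, submodules of flat modules are flat. -/
lemma Submodule.flat_of_isBezout {R : Type*} [CommRing R] [IsDomain R] [IsBezout R]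
    {M : Type*} [AddCommGroup M] [Module R M] [Module.Flat R M] (S : Submodule R M) :
    Module.Flat R S := by
  rw [Module.Flat.flat_iff_torsion_eq_bot_of_isBezout, eq_bot_iff]
  rintro x ⟨r, hr⟩
  have h : (x : M) ∈ Submodule.torsion R M := ⟨r, by simpa using congrArg Subtype.val hr⟩
  rw [Module.Flat.torsion_eq_bot, Submodule.mem_bot] at h
  simpa using h

open Limits in
lemma isZero_tor_succ_of_flat {R : Type u} [CommRing R] (G : Type u) [AddCommGroup G] [Module R G]
    [Module.Flat R G] (N : ModuleCat.{u} R) (n : ℕ) :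
    IsZero (((Tor (ModuleCat.{u} R) (n + 1)).obj (ModuleCat.of R G)).obj N) :=
  (isZero_tor_succ_iff G (projectiveResolution N) n).2
    (Module.Flat.lTensor_exact G ((projectiveResolution N).function_exact_succ n))

open Limits in
/-- Over a Bezout domain, `Tor_2` vanishes. -/
lemma isZero_tor_two_of_isBezout {R : Type u} [CommRing R] [IsDomain R] [IsBezout R]
    (G : Type u) [AddCommGroup G] [Module R G] (N : ModuleCat.{u} R) :
    IsZero (((Tor (ModuleCat.{u} R) 2).obj (ModuleCat.of R G)).obj N) := by
  let P := projectiveResolution N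
  refine (isZero_tor_succ_iff G P 1).2 ?_
  set d₁ := (P.complex.d 1 0).hom
  set d₂ := (P.complex.d 2 1).hom
  have h₁ : Function.Exact d₂ d₁ := P.function_exact_succ 0
  have : Module.Projective R (P.complex.X 0) :=
    (IsProjective.iff_projective _).2 (inferInstanceAs (Projective (P.complex.X 0)))
  have : Module.Flat R (LinearMap.range d₁) := Submodule.flat_of_isBezout _
  have h₃ : Function.Exact (LinearMap.range d₂).subtype d₁.rangeRestrict := by
    intro y
    rw [← Subtype.coe_inj, Submodule.coe_subtype, Subtype.range_coe]
    exact h₁ y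
  have hinj := LinearMap.lTensor_injective_of_exact_of_flat d₁.rangeRestrict
    d₁.surjective_rangeRestrict _ (LinearMap.range d₂).injective_subtype h₃ G
  have h₄ : Function.Exact (P.complex.d 3 2).hom d₂.rangeRestrict := by
    intro y
    rw [← Subtype.coe_inj]
    exact P.function_exact_succ 1 y
  have h₅ := lTensor_exact G h₄ d₂.surjective_rangeRestrict
  intro y
  rw [← h₅ y, ← hinj.eq_iff, map_zero, ← LinearMap.comp_apply, ← LinearMap.lTensor_comp,
    LinearMap.subtype_comp_codRestrict]

open Limits TensorProduct in
/-- If `Tor_1(G, R / (s))` vanishes for a nonzero `s` in a domain, then `G` has no `s`-torsion. -/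
lemma eq_zero_of_isZero_tor_one {R : Type u} [CommRing R] [IsDomain R]
    (G : Type u) [AddCommGroup G] [Module R G] {s : R} (hs : s ≠ 0)
    (h : IsZero (((Tor (ModuleCat.{u} R) 1).obj (ModuleCat.of R G)).obj
      (ModuleCat.of R (R ⧸ Ideal.span {s})))) {x : G} (hx : s • x = 0) : x = 0 := by
  let P := projectiveResolution (ModuleCat.of R (R ⧸ Ideal.span {s}))
  have hT := (isZero_tor_succ_iff G P 0).1 h
  set d₁ := (P.complex.d 1 0).hom
  set d₂ := (P.complex.d 2 1).hom
  have hd : Function.Exact d₂ d₁ := P.function_exact_succ 0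
  have : Module.Projective R (P.complex.X 0) :=
    (IsProjective.iff_projective _).2 (inferInstanceAs (Projective (P.complex.X 0)))
  let e : P.complex.X 0 →ₗ[R] R ⧸ Ideal.span {s} := (P.π.f 0).hom
  have he : Function.Exact d₁ e :=
    (ShortComplex.ShortExact.moduleCat_exact_iff_function_exact _).1 P.exact₀
  have hesurj : Function.Surjective e :=
    (ModuleCat.epi_iff_surjective (P.π.f 0)).1 inferInstance
  obtain ⟨φ, hφ⟩ := Module.projective_lifting_property (Submodule.mkQ (Ideal.span {s})) e
    (Submodule.mkQ_surjective _)
  obtain ⟨a, ha⟩ := hesurj (Submodule.Quotient.mk 1)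
  have hsa : e (s • a) = 0 := by
    rw [map_smul, ha, ← Submodule.Quotient.mk_smul, Submodule.Quotient.mk_eq_zero]
    exact Ideal.mem_span_singleton.2 (by simp)
  obtain ⟨p, hp⟩ := (he _).1 hsa
  -- `φ ∘ d₁` factors through multiplication by `s`
  have hdvd : ∀ q, ∃ c, φ (d₁ q) = s * c := fun q ↦ by
    have h0 : (Submodule.mkQ (Ideal.span {s})) (φ (d₁ q)) = 0 := by
      rw [← LinearMap.comp_apply, hφ]
      exact (he _).2 ⟨q, rfl⟩
    rw [Submodule.mkQ_apply, Submodule.Quotient.mk_eq_zero] at h0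
    exact Ideal.mem_span_singleton.1 h0
  choose c hc using hdvd
  let ψ : P.complex.X 1 →ₗ[R] R :=
    { toFun := c
      map_add' := fun q q' ↦ mul_left_cancel₀ hs (by
        rw [mul_add, ← hc, ← hc, ← hc, map_add, map_add])
      map_smul' := fun r q ↦ mul_left_cancel₀ hs (by
        rw [← hc, map_smul, map_smul, hc, RingHom.id_apply, smul_eq_mul, smul_eq_mul,
          mul_left_comm]) }
  have hψd : ψ ∘ₗ d₂ = 0 := by
    ext z
    refine mul_left_cancel₀ hs ((hc (d₂ z)).symm.trans ?_)
    rw [(hd (d₂ z)).2 ⟨z, rfl⟩, map_zero, LinearMap.zero_apply, mul_zero]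
  have hcp : c p = φ a := mul_left_cancel₀ hs (by rw [← hc, hp, map_smul, smul_eq_mul])
  obtain ⟨b, hb⟩ : ∃ b, φ a - 1 = s * b := by
    have h1 : (Submodule.mkQ (Ideal.span {s})) (φ a) = Submodule.Quotient.mk 1 := by
      rw [← LinearMap.comp_apply, hφ, ha]
    exact Ideal.mem_span_singleton.1 ((Submodule.Quotient.eq _).1 h1)
  have hker : LinearMap.lTensor G d₁ (x ⊗ₜ p) = 0 := by
    rw [LinearMap.lTensor_tmul, hp, TensorProduct.tmul_smul, TensorProduct.smul_tmul', hx,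
      TensorProduct.zero_tmul]
  obtain ⟨y, hy⟩ := (hT _).1 hker
  have hz : x ⊗ₜ[R] c p = (0 : G ⊗[R] R) := by
    have := congrArg (LinearMap.lTensor G ψ) hy
    rw [← LinearMap.comp_apply, ← LinearMap.lTensor_comp, hψd, LinearMap.lTensor_zero] at this
    exact this.symm
  have hcx : c p • x = 0 := by simpa using congrArg (TensorProduct.rid R G) hz
  rw [hcp, eq_add_of_sub_eq hb, add_smul, one_smul, mul_comm, mul_smul, hx, smul_zero,
    zero_add] at hcx
  exact hcx

lemma weakDim_le_of_isZero_tor {R : Type u} [CommRing R] {M : Type u} [AddCommGroup M] [Module R M]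
    (k : ℕ) (h : ∀ N : ModuleCat.{u} R,
      Limits.IsZero (((Tor (ModuleCat.{u} R) (k + 1)).obj (ModuleCat.of R M)).obj N)) :
    weakDim R M ≤ k :=
  sInf_le ⟨k, rfl, h⟩

lemma one_le_weakDim_of_not_isZero_tor {R : Type u} [CommRing R] {M : Type u} [AddCommGroup M]
    [Module R M] (N : ModuleCat.{u} R)
    (h : ¬ Limits.IsZero (((Tor (ModuleCat.{u} R) 1).obj (ModuleCat.of R M)).obj N)) :
    1 ≤ weakDim R M := by
  refine le_sInf ?_
  rintro _ ⟨k, rfl, hk⟩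
  rcases k with _ | k
  · exact absurd (hk N) h
  · exact_mod_cast Nat.succ_pos k

/-- Over a valuation domain `R` which is not a field, a nonzero almost
FP-injective module `G` has `w.d.(G) = 0` if `G_♯ = 0` (`G` torsion-free), and
`w.d.(G) = 1` if `G_♯ ≠ 0`. -/
theorem weakDim_of_almostFPInjective_valuationDomain (R : Type u) [CommRing R]
    [IsDomain R] (hR : IsChainRing R) (hnf : ¬ IsField R)
    (G : Type u) [AddCommGroup G] [Module R G] [Nontrivial G]
    (hG : IsAlmostFPInjective R G) :
    (bottomSet R G = {0} → weakDim R G = 0) ∧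
    (bottomSet R G ≠ {0} → weakDim R G = 1) := by
  have hV : ValuationRing R := ValuationRing.iff_ideal_total.2 ⟨hR⟩
  refine ⟨fun h ↦ ?_, fun h ↦ ?_⟩
  · have : Module.Flat R G := by
      rw [Module.Flat.flat_iff_torsion_eq_bot_of_isBezout, eq_bot_iff]
      rintro x ⟨r, hr⟩
      by_contra hx
      have hmem : (r : R) ∈ bottomSet R G := ⟨x, hx, hr⟩
      rw [h] at hmem
      exact nonZeroDivisors.coe_ne_zero r hmem
    exact nonpos_iff_eq_zero.1 (weakDim_le_of_isZero_tor 0 fun N ↦ isZero_tor_succ_of_flat G N 0)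
  · refine le_antisymm (weakDim_le_of_isZero_tor 1 fun N ↦ isZero_tor_two_of_isBezout G N) ?_
    obtain ⟨s, ⟨x, hx, hsx⟩, hs⟩ : ∃ s ∈ bottomSet R G, s ≠ 0 := by
      by_contra! hall
      obtain ⟨x, hx⟩ := exists_ne (0 : G)
      exact h (Set.eq_singleton_iff_unique_mem.2 ⟨⟨x, hx, zero_smul R x⟩, hall⟩)
    exact one_le_weakDim_of_not_isZero_tor _ fun h0 ↦ hx (eq_zero_of_isZero_tor_one G hs h0 hsx)
end
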